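/- Let (Ω, μ) be a finite measure space, V₀ ∈ (0,1), and let (f_k)_{k∈ℕ} be a sequence in the admissible class F(V₀) such that Σ_{k=0}^∞ ‖f_{k+1} − f_k‖²_{L¹(μ)} < ∞. Assume: (i) every subsequence of (f_k) admits a further subsequence (f_{k_j}) and a measurable set E ⊆ Ω with μ(E) = V₀ μ(Ω) such that ∫_Ω f_{k_j} g dμ → ∫_Ω 1_E g dμ for all bounded measurable g; and (ii) there is δ > 0 such that any two distinct L¹-closure points F, F′ of (f_k) satisfy ‖F − F′‖_{L¹(μ)} ≥ δ. Then there is a measurable set E_∞ ⊆ Ω with μ(E_∞) = V₀ μ(Ω) such that f_k → 1_{E_∞} strongly in L¹(μ). -/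

import Mathlib

open MeasureTheory Filter Topology

theorem aux_metric {X : Type*} [MetricSpace X] (u : ℕ → X) (δ : ℝ) (hδ : 0 < δ)
    (hstep : Tendsto (fun k => dist (u (k+1)) (u k)) atTop (𝓝 0))
    (hcpt : ∀ φ : ℕ → ℕ, StrictMono φ → ∃ ψ : ℕ → ℕ, StrictMono ψ ∧ ∃ G,
      Tendsto (fun j => u (φ (ψ j))) atTop (𝓝 G))
    (hsep : ∀ F F' : X, (∃ φ : ℕ → ℕ, StrictMono φ ∧ Tendsto (fun j => u (φ j)) atTop (𝓝 F)) →
      (∃ φ : ℕ → ℕ, StrictMono φ ∧ Tendsto (fun j => u (φ j)) atTop (𝓝 F')) →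
      F ≠ F' → δ ≤ dist F F')
    (F : X) (hF : ∃ φ : ℕ → ℕ, StrictMono φ ∧ Tendsto (fun j => u (φ j)) atTop (𝓝 F)) :
    Tendsto u atTop (𝓝 F) := by
  have hr : 0 < δ / 3 := by positivity
  have hev : ∀ᶠ k in atTop, dist (u k) F < δ / 3 := by
    by_contra hne
    have hfar : ∃ᶠ k in atTop, δ / 3 ≤ dist (u k) F := by
      simpa [Filter.Frequently] using hne
    have hann : ∃ᶠ k in atTop, δ / 3 ≤ dist (u k) F ∧ dist (u k) F ≤ 2 * (δ / 3) := by
      rw [frequently_atTop]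
      intro N
      obtain ⟨N1, hN1⟩ := eventually_atTop.1 (hstep.eventually (gt_mem_nhds hr))
      obtain ⟨φ, hφ, hlim⟩ := hF
      have h1 : ∀ᶠ j in atTop, dist (u (φ j)) F < δ / 3 :=
        hlim.eventually (Metric.ball_mem_nhds F hr)
      obtain ⟨j, hj1, hj2⟩ := (h1.and (hφ.tendsto_atTop.eventually_ge_atTop (max N N1))).exists
      by_contra hno
      push Not at hno
      have hall : ∀ k, φ j ≤ k → dist (u k) F < δ / 3 := by
        intro k hk
        induction k, hk using Nat.le_induction with
        | base => exact hj1
        | succ k hk ih =>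
          by_contra hge
          have h2 := hno (k+1) (by have := le_max_left N N1; omega) (not_lt.1 hge)
          have h3 := hN1 k (by have := le_max_right N N1; omega)
          have := dist_triangle (u (k+1)) (u k) F
          linarith
      obtain ⟨k, hk, hk2⟩ := frequently_atTop.1 hfar (φ j)
      exact absurd (hall k hk) (not_lt.2 hk2)
    obtain ⟨φ, hφ, hp⟩ := extraction_of_frequently_atTop hann
    obtain ⟨ψ, hψ, G, hG⟩ := hcpt φ hφ
    have hd : Tendsto (fun j => dist (u (φ (ψ j))) F) atTop (𝓝 (dist G F)) :=
      hG.dist tendsto_const_nhds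
    have hlo : δ / 3 ≤ dist G F := ge_of_tendsto' hd fun j => (hp (ψ j)).1
    have hhi : dist G F ≤ 2 * (δ / 3) := le_of_tendsto' hd fun j => (hp (ψ j)).2
    have := hsep G F ⟨fun j => φ (ψ j), hφ.comp hψ, hG⟩ hF (dist_pos.1 (by linarith))
    linarith
  refine tendsto_of_subseq_tendsto fun ns hns => ?_
  obtain ⟨φ, -, hφ2⟩ := strictMono_subseq_of_tendsto_atTop hns
  obtain ⟨ψ, hψ, G, hG⟩ := hcpt (ns ∘ φ) hφ2
  have hGF : G = F := by
    by_contra hne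
    have h1 := hsep G F ⟨fun j => (ns ∘ φ) (ψ j), hφ2.comp hψ, hG⟩ hF hne
    have hd : Tendsto (fun j => dist (u ((ns ∘ φ) (ψ j))) F) atTop (𝓝 (dist G F)) :=
      hG.dist tendsto_const_nhds
    have : dist G F ≤ δ / 3 := le_of_tendsto hd
      (((hφ2.comp hψ).tendsto_atTop.eventually hev).mono fun j hj => hj.le)
    linarith
  exact ⟨φ ∘ ψ, hGF ▸ hG⟩

theorem aux_norm {Ω : Type*} [MeasurableSpace Ω] (μ : Measure Ω) [IsFiniteMeasure μ]
    (f : Lp ℝ 1 μ) (E : Set Ω) (hE : MeasurableSet E) :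
    dist f (indicatorConstLp 1 hE (measure_ne_top μ E) (1:ℝ)) =
      ∫ x, |f x - E.indicator (fun _ => (1 : ℝ)) x| ∂μ := by
  rw [dist_eq_norm, L1.norm_eq_integral_norm]
  refine integral_congr_ae ?_
  filter_upwards [Lp.coeFn_sub f (indicatorConstLp 1 hE (measure_ne_top μ E) (1:ℝ)),
    indicatorConstLp_coeFn (p := 1) (hs := hE) (hμs := measure_ne_top μ E) (c := (1:ℝ))]
    with x h1 h2
  rw [h1, Pi.sub_apply, h2, Real.norm_eq_abs]

theorem aux_int {Ω : Type*} [MeasurableSpace Ω] (μ : Measure Ω) [IsFiniteMeasure μ]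
    (f : Lp ℝ 1 μ) (hf : ∀ᵐ x ∂μ, 0 ≤ f x ∧ f x ≤ 1) (E : Set Ω) (hE : MeasurableSet E) :
    ∫ x, |f x - E.indicator (fun _ => (1 : ℝ)) x| ∂μ =
      ∫ x, f x * (1 - 2 * E.indicator (fun _ => (1 : ℝ)) x) ∂μ + μ.real E := by
  have hfi : Integrable f μ := L1.integrable_coeFn f
  have hEi : Integrable (E.indicator (fun _ => (1 : ℝ))) μ :=
    (integrable_const 1).indicator hE
  have hm : Integrable (fun x => f x * (1 - 2 * E.indicator (fun _ => (1 : ℝ)) x)) μ := by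
    refine hfi.mul_bdd (c := 1) ?_ ?_
    · exact (measurable_const.sub
        ((measurable_const.indicator hE).const_mul 2)).aestronglyMeasurable
    · refine Eventually.of_forall fun x => ?_
      by_cases hx : x ∈ E <;> simp [hx] <;> norm_num
  have h1 : μ.real E = ∫ x, E.indicator (fun _ => (1 : ℝ)) x ∂μ := by
    rw [integral_indicator hE]; simp
  rw [h1, ← integral_add hm hEi]
  refine integral_congr_ae ?_
  filter_upwards [hf] with x hx
  by_cases hxE : x ∈ E
  · simp only [hxE, Set.indicator_of_mem]
    rw [abs_of_nonpos (by linarith)]; ring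
  · simp [hxE, abs_of_nonneg hx.1]

/-- Let `(f_k)` be a sequence in the admissible class `F(V₀) ⊆ L¹(μ)`
with square-summable `L¹` increments. Assume (i) every subsequence has a further
subsequence converging weakly-* to a bang-bang function `1_E` with `μ E = V₀ μ(Ω)`, and
(ii) distinct `L¹`-closure points are `δ`-separated for some `δ > 0`. Then there is a
measurable `E_∞` with `μ E_∞ = V₀ μ(Ω)` such that `f_k → 1_{E_∞}` strongly in `L¹(μ)`. -/
theorem strong_L1_convergence_to_bangbang
    {Ω : Type*} [MeasurableSpace Ω] (μ : Measure Ω) [IsFiniteMeasure μ]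
    (V₀ : ℝ) (hV₀ : V₀ ∈ Set.Ioo (0 : ℝ) 1)
    (f : ℕ → Lp ℝ 1 μ)
    (hmem : ∀ k, (∀ᵐ x ∂μ, 0 ≤ f k x ∧ f k x ≤ 1) ∧
      ∫ x, f k x ∂μ = V₀ * (μ Set.univ).toReal)
    (hsum : Summable fun k => ‖f (k + 1) - f k‖ ^ 2)
    (hbang : ∀ φ : ℕ → ℕ, StrictMono φ → ∃ ψ : ℕ → ℕ, StrictMono ψ ∧ ∃ E : Set Ω,
      MeasurableSet E ∧ μ E = ENNReal.ofReal V₀ * μ Set.univ ∧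
      ∀ g : Ω → ℝ, Measurable g → (∃ M, ∀ x, |g x| ≤ M) →
        Tendsto (fun j => ∫ x, f (φ (ψ j)) x * g x ∂μ) atTop (𝓝 (∫ x in E, g x ∂μ)))
    (hsep : ∃ δ : ℝ, 0 < δ ∧ ∀ F F' : Lp ℝ 1 μ,
      (∃ φ : ℕ → ℕ, StrictMono φ ∧ Tendsto (fun j => f (φ j)) atTop (𝓝 F)) →
      (∃ φ : ℕ → ℕ, StrictMono φ ∧ Tendsto (fun j => f (φ j)) atTop (𝓝 F')) →
      F ≠ F' → δ ≤ ‖F - F'‖) :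
    ∃ E : Set Ω, MeasurableSet E ∧ μ E = ENNReal.ofReal V₀ * μ Set.univ ∧
      Tendsto (fun k => ∫ x, |f k x - E.indicator (fun _ => (1 : ℝ)) x| ∂μ) atTop (𝓝 0) := by
  obtain ⟨δ, hδ, hsep⟩ := hsep
  have key : ∀ φ : ℕ → ℕ, StrictMono φ → ∃ ψ : ℕ → ℕ, StrictMono ψ ∧ ∃ E : Set Ω,
      ∃ hE : MeasurableSet E, μ E = ENNReal.ofReal V₀ * μ Set.univ ∧
      Tendsto (fun j => f (φ (ψ j))) atTop
        (𝓝 (indicatorConstLp 1 hE (measure_ne_top μ E) (1:ℝ))) := by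
    intro φ hφ
    obtain ⟨ψ, hψ, E, hE, hμ, hw⟩ := hbang φ hφ
    refine ⟨ψ, hψ, E, hE, hμ, ?_⟩
    rw [tendsto_iff_dist_tendsto_zero]
    have h1 := (hw (fun x => 1 - 2 * E.indicator (fun _ => (1 : ℝ)) x)
      (measurable_const.sub ((measurable_const.indicator hE).const_mul 2))
      ⟨1, fun x => by by_cases hx : x ∈ E <;> simp [hx] <;> norm_num⟩).add_const (μ.real E)
    have h2 : ∫ x in E, (1 - 2 * E.indicator (fun _ => (1 : ℝ)) x) ∂μ = - μ.real E := by
      rw [setIntegral_congr_fun (g := fun _ => (-1 : ℝ)) hE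
        (fun x hx => by simp [hx]; norm_num)]
      simp
    rw [h2, neg_add_cancel] at h1
    refine h1.congr fun j => ?_
    rw [aux_norm, aux_int μ _ (hmem _).1 E hE]
  obtain ⟨ψ, hψ, E, hE, hμ, hlim⟩ := key id strictMono_id
  refine ⟨E, hE, hμ, ?_⟩
  have hstep : Tendsto (fun k => dist (f (k+1)) (f k)) atTop (𝓝 0) := by
    have h := hsum.tendsto_atTop_zero.sqrt
    simpa [dist_eq_norm, Real.sqrt_sq] using h
  have hfin := aux_metric f δ hδ hstep
    (fun φ hφ => by
      obtain ⟨ψ, hψ, E, hE, -, h⟩ := key φ hφ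
      exact ⟨ψ, hψ, _, h⟩)
    (fun F F' h h' hne => by rw [dist_eq_norm]; exact hsep F F' h h' hne)
    _ ⟨ψ, hψ, hlim⟩
  rw [tendsto_iff_dist_tendsto_zero] at hfin
  exact hfin.congr fun k => aux_norm μ (f k) E hE
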